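/- arXiv:2004.10526 — 2 statements merged into one kernel-verified Lean document; each statement's English description precedes it below -/
import Mathlib

section
/- Let n > 1 be an odd integer. Then, modulo [n]·Φ_n(q), the following q-congruence of rational functions holds: (q;q^2)_{n-1} / (q;q)_{n-1} ≡ -[n]·q. -/
open Finset Polynomial

/-- The variable `q`, viewed as a rational function over `ℚ`. -/
noncomputable def q : RatFunc ℚ := RatFunc.X

/-- The q-shifted factorial `(a; b)_n = (1-a)(1-ab)⋯(1-ab^{n-1})`. -/
noncomputable def qpoch (a b : RatFunc ℚ) (n : ℕ) : RatFunc ℚ :=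
  ∏ i ∈ Finset.range n, (1 - a * b ^ i)

/-- The q-integer `[m] = (1-q^m)/(1-q)` (for an arbitrary integer `m`). -/
noncomputable def qint (m : ℤ) : RatFunc ℚ := (1 - q ^ m) / (1 - q)

/-- The q-integer `[n] = 1 + q + ⋯ + q^{n-1}` as a polynomial. -/
noncomputable def qintPoly (n : ℕ) : Polynomial ℚ := ∑ i ∈ Finset.range n, Polynomial.X ^ i

/-- The central q-binomial coefficient `[2k choose k] = (q;q)_{2k}/(q;q)_k^2`. -/
noncomputable def qcb (k : ℕ) : RatFunc ℚ := qpoch q q (2 * k) / (qpoch q q k) ^ 2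

/-- Two rational functions are congruent modulo a polynomial `P` iff `P` divides the
numerator of the reduced form of their difference. -/
def ratCongr (A B : RatFunc ℚ) (P : Polynomial ℚ) : Prop := P ∣ (A - B).num

/-- The polynomial `(q;q)_m`. -/
noncomputable def qfacPoly (m : ℕ) : ℚ[X] := ∏ i ∈ range m, (1 - X ^ (i + 1))

/-- The polynomial `(-q;q)_m`. -/
noncomputable def qplusPoly (m : ℕ) : ℚ[X] := ∏ i ∈ range m, (1 + X ^ (i + 1))

/-- The polynomial `(q;q^2)_m`. -/
noncomputable def qoddPoly (m : ℕ) : ℚ[X] := ∏ i ∈ range m, (1 - X ^ (2 * i + 1))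

lemma one_sub_X_pow_ne_zero {m : ℕ} (hm : m ≠ 0) : (1 - X ^ m : ℚ[X]) ≠ 0 := fun h => by
  have := congrArg (eval 0) h
  simp [hm] at this

lemma qfacPoly_ne_zero (m : ℕ) : qfacPoly m ≠ 0 :=
  prod_ne_zero_iff.2 fun i _ => one_sub_X_pow_ne_zero i.succ_ne_zero

lemma qplusPoly_ne_zero (m : ℕ) : qplusPoly m ≠ 0 :=
  prod_ne_zero_iff.2 fun i _ h => by
    have := congrArg (eval 0) h
    simp at this

lemma qfacPoly_succ (m : ℕ) : qfacPoly (m + 1) = qfacPoly m * (1 - X ^ (m + 1)) :=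
  prod_range_succ _ _

lemma qfacPoly_add (m k : ℕ) :
    qfacPoly (m + k) = qfacPoly m * ∏ i ∈ range k, (1 - X ^ (m + i + 1)) :=
  prod_range_add _ _ _

/-- The Gaussian binomial coefficients are polynomials. -/
lemma qfacPoly_mul_dvd (m k : ℕ) : qfacPoly m * qfacPoly k ∣ qfacPoly (m + k) := by
  induction m generalizing k with
  | zero => simp [qfacPoly]
  | succ m ihm =>
    induction k with
    | zero => simp [qfacPoly]
    | succ k ihk =>
      have h : qfacPoly (m + 1 + (k + 1)) = qfacPoly (m + (k + 1)) * (1 - X ^ (m + 1)) +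
          X ^ (m + 1) * (qfacPoly (m + 1 + k) * (1 - X ^ (k + 1))) := by
        rw [show m + 1 + (k + 1) = m + (k + 1) + 1 by ring, qfacPoly_succ,
          show m + 1 + k = m + (k + 1) by ring]
        ring
      rw [h]
      refine dvd_add ?_ (Dvd.dvd.mul_left ?_ _)
      · rw [qfacPoly_succ m, mul_right_comm]
        exact mul_dvd_mul_right (ihm (k + 1)) _
      · rw [qfacPoly_succ k, ← mul_assoc]
        exact mul_dvd_mul_right ihk _

lemma qoddPoly_mul_qfacPoly_mul_qplusPoly (m : ℕ) :
    qoddPoly m * qfacPoly m * qplusPoly m = qfacPoly (2 * m) := by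
  induction m with
  | zero => simp [qoddPoly, qfacPoly, qplusPoly]
  | succ m ih =>
    rw [show 2 * (m + 1) = 2 * m + 1 + 1 by ring, qfacPoly_succ m, qfacPoly_succ,
      qfacPoly_succ, ← ih, qoddPoly, qplusPoly, prod_range_succ, prod_range_succ, ← qoddPoly,
      ← qplusPoly]
    ring

lemma one_sub_X_mul_qintPoly (m : ℕ) : (1 - X) * qintPoly m = 1 - X ^ m :=
  mul_neg_geom_sum _ _

lemma qintPoly_ne_zero {m : ℕ} (hm : m ≠ 0) : qintPoly m ≠ 0 := fun h =>
  one_sub_X_pow_ne_zero hm (by rw [← one_sub_X_mul_qintPoly, h, mul_zero])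

lemma qintPoly_root {m : ℕ} {z : ℂ} (hz : aeval z (qintPoly m) = 0) : z ^ m = 1 := by
  have h := congrArg (aeval z) (one_sub_X_mul_qintPoly m)
  simp only [map_mul, hz, mul_zero, map_sub, map_one, map_pow, aeval_X] at h
  exact (sub_eq_zero.1 h.symm).symm

lemma isCoprime_qintPoly {m k : ℕ} (hmk : m.Coprime k) :
    IsCoprime (qintPoly k) (qintPoly m) := by
  rw [isCoprime_iff_aeval_ne_zero_of_isAlgClosed ℚ ℂ]
  by_contra! ⟨z, hk, hm⟩
  have hz : z = 1 := by
    simpa [hmk] using pow_gcd_eq_one.2 ⟨qintPoly_root hm, qintPoly_root hk⟩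
  subst hz
  simp [qintPoly] at hk hm
  simp [hk, hm] at hmk

lemma isCoprime_qintPoly_qplusPoly {m k : ℕ} (hk : Odd k) :
    IsCoprime (qintPoly k) (qplusPoly m) := by
  rw [isCoprime_iff_aeval_ne_zero_of_isAlgClosed ℚ ℂ]
  by_contra! ⟨z, hz, hm⟩
  simp only [qplusPoly, map_prod, prod_eq_zero_iff, map_add, map_one, map_pow, aeval_X] at hm
  obtain ⟨i, -, hi⟩ := hm
  have h : (z ^ (i + 1)) ^ k = 1 := by rw [← pow_mul, mul_comm, pow_mul, qintPoly_root hz, one_pow]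
  rw [eq_neg_of_add_eq_zero_right hi, hk.neg_one_pow] at h
  norm_num at h

/-- With `A` the Gaussian binomial coefficient of `2m+1` over `m`, this expresses
`(q;q^2)_m / (q;q)_m` as `[m+1] A / ((-q;q)_m [2m+1])`. -/
lemma qoddPoly_mul_eq {m : ℕ} {A : ℚ[X]}
    (hA : qfacPoly (m + (m + 1)) = qfacPoly m * qfacPoly (m + 1) * A) :
    qoddPoly m * (qplusPoly m * qintPoly (2 * m + 1)) = qintPoly (m + 1) * A * qfacPoly m := by
  rw [← add_assoc, ← two_mul, qfacPoly_succ, qfacPoly_succ, ← qoddPoly_mul_qfacPoly_mul_qplusPoly,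
    ← one_sub_X_mul_qintPoly, ← one_sub_X_mul_qintPoly] at hA
  have hX : (1 - X : ℚ[X]) ≠ 0 := by simpa using one_sub_X_pow_ne_zero one_ne_zero
  refine mul_left_cancel₀ (mul_ne_zero hX (qfacPoly_ne_zero m)) ?_
  linear_combination hA

lemma cyclotomic_dvd_add {m : ℕ} (hm : m ≠ 0) (hodd : Odd (m + 1)) {A : ℚ[X]}
    (hA : qfacPoly (m + (m + 1)) = qfacPoly m * qfacPoly (m + 1) * A) :
    cyclotomic (m + 1) ℚ ∣ A + X * (qplusPoly m * qintPoly (2 * m + 1)) := by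
  obtain ⟨z, hz⟩ : ∃ z : ℂ, IsPrimitiveRoot z (m + 1) :=
    ⟨_, Complex.isPrimitiveRoot_exp _ m.succ_ne_zero⟩
  have hz2 : IsPrimitiveRoot (z ^ 2) (m + 1) :=
    hz.pow_of_coprime 2 (Nat.coprime_two_left.2 hodd)
  have hne : (m + 1 : ℂ) ≠ 0 := by exact_mod_cast m.succ_ne_zero
  have hfac : aeval z (qfacPoly m) = m + 1 := by
    simpa [qfacPoly] using hz.prod_one_sub_pow_eq_order
  have hplus : aeval z (qplusPoly m) = 1 := by
    have h : aeval z (qfacPoly m) * aeval z (qplusPoly m) = m + 1 := by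
      rw [← hz2.prod_one_sub_pow_eq_order, ← map_mul, qfacPoly, qplusPoly, ← prod_mul_distrib,
        map_prod]
      refine prod_congr rfl fun i _ => ?_
      simp only [map_mul, map_sub, map_add, map_one, map_pow, aeval_X]
      ring
    rw [hfac] at h
    exact mul_left_cancel₀ hne (h.trans (mul_one _).symm)
  have hAz : aeval z A = 1 := by
    rw [add_comm m (m + 1), qfacPoly_add, mul_comm (qfacPoly m), mul_assoc] at hA
    have h := congrArg (aeval z) (mul_left_cancel₀ (qfacPoly_ne_zero _) hA)
    have h' : aeval z (∏ i ∈ range m, (1 - X ^ (m + 1 + i + 1)) : ℚ[X]) =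
        aeval z (qfacPoly m) := by
      simp [qfacPoly, add_assoc (m + 1), pow_add z (m + 1), hz.pow_eq_one]
    rw [h', map_mul, hfac] at h
    exact mul_left_cancel₀ hne (h.symm.trans (mul_one _).symm)
  have hint : z * aeval z (qintPoly (2 * m + 1)) = -1 := by
    have h := congrArg (aeval z) (one_sub_X_mul_qintPoly (2 * m + 1))
    simp only [map_mul, map_sub, map_one, map_pow, aeval_X] at h
    have h1 : 1 - z ≠ 0 := sub_ne_zero.2 (hz.ne_one (by omega)).symm
    have h2 : z ^ (2 * m + 1) * z = 1 := by
      rw [← pow_succ, show 2 * m + 1 + 1 = (m + 1) * 2 by ring, pow_mul, hz.pow_eq_one, one_pow]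
    refine mul_left_cancel₀ h1 ?_
    linear_combination z * h - h2
  rw [cyclotomic_eq_minpoly_rat hz m.succ_pos]
  refine minpoly.dvd _ _ ?_
  simp only [map_add, map_mul, aeval_X, hAz, hplus, one_mul, hint, add_neg_cancel]

lemma dvd_num_of_eq_div {x : RatFunc ℚ} {M P B : ℚ[X]} (hB : B ≠ 0) (hMB : IsCoprime M B)
    (hMP : M ∣ P) (hx : x = algebraMap _ _ P / algebraMap _ _ B) : M ∣ x.num :=
  hMB.dvd_of_dvd_mul_right <| by
    rw [(RatFunc.num_mul_eq_mul_denom_iff hB).2 hx]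
    exact hMP.mul_right _

lemma qpoch_q_q (m : ℕ) : qpoch q q m = algebraMap _ _ (qfacPoly m) := by
  simp [qpoch, qfacPoly, q, RatFunc.algebraMap_X, pow_succ']

lemma qpoch_q_q_sq (m : ℕ) : qpoch q (q ^ 2) m = algebraMap _ _ (qoddPoly m) := by
  simp [qpoch, qoddPoly, q, RatFunc.algebraMap_X, pow_succ', pow_mul]

lemma qint_natCast (m : ℕ) : qint m = algebraMap _ _ (qintPoly m) := by
  have hX : (1 - RatFunc.X : RatFunc ℚ) ≠ 0 := by
    simpa using (RatFunc.algebraMap_ne_zero (one_sub_X_pow_ne_zero one_ne_zero) :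
      algebraMap ℚ[X] (RatFunc ℚ) (1 - X ^ 1) ≠ 0)
  have h := congrArg (algebraMap ℚ[X] (RatFunc ℚ)) (one_sub_X_mul_qintPoly m)
  simp only [map_mul, map_sub, map_one, map_pow, RatFunc.algebraMap_X] at h
  rw [qint, q, zpow_natCast, div_eq_iff hX, ← h, mul_comm]

theorem stmt_10 (n : ℕ) (hn : 1 < n) (hodd : Odd n) :
    ratCongr (qpoch q (q ^ 2) (n - 1) / qpoch q q (n - 1)) (-(qint n) * q)
      (qintPoly n * Polynomial.cyclotomic n ℚ) := by
  obtain ⟨m, rfl⟩ : ∃ m, n = m + 1 := ⟨n - 1, by omega⟩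
  obtain ⟨A, hA⟩ := qfacPoly_mul_dvd m (m + 1)
  have hcop : IsCoprime (qintPoly (m + 1)) (qplusPoly m * qintPoly (2 * m + 1)) :=
    (isCoprime_qintPoly_qplusPoly hodd).mul_right
      (isCoprime_qintPoly (by rw [show 2 * m + 1 = m + (m + 1) by ring]; simp))
  have hB : qplusPoly m * qintPoly (2 * m + 1) ≠ 0 :=
    mul_ne_zero (qplusPoly_ne_zero m) (qintPoly_ne_zero (by omega))
  refine dvd_num_of_eq_div hB ?_ ?_ ?_
    (P := qintPoly (m + 1) * (A + X * (qplusPoly m * qintPoly (2 * m + 1))))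
  · exact hcop.mul_left (hcop.of_isCoprime_of_dvd_left
      (cyclotomic_dvd_geom_sum_of_dvd ℚ dvd_rfl (by omega)))
  · exact mul_dvd_mul_left _ (cyclotomic_dvd_add (by omega) hodd hA)
  · have h := congrArg (algebraMap ℚ[X] (RatFunc ℚ)) (qoddPoly_mul_eq hA)
    have hF := RatFunc.algebraMap_ne_zero (qfacPoly_ne_zero m)
    have hB' := RatFunc.algebraMap_ne_zero hB
    rw [map_mul, map_mul _ _ (qfacPoly m)] at h
    rw [qint_natCast, Nat.add_sub_cancel, qpoch_q_q, qpoch_q_q_sq, q, ← RatFunc.algebraMap_X,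
      (div_eq_div_iff hF hB').2 h, mul_add, map_add, map_mul _ _ (X * _), map_mul _ X]
    field_simp
    ring
end

section
/- With F and G defined as below, for all integers n ≥ 0 and all integers k, the q-WZ pair identity F(n,k-1) - F(n,k) = G(n+1,k) - G(n,k) holds as an identity of rational functions in q. -/
open Finset Polynomial

/-- The function `F(n,k)` of the q-WZ pair. -/
noncomputable def F (n : ℕ) (k : ℤ) : RatFunc ℚ :=
  qint (3 * n + 2 * k + 1) * qpoch q (q ^ 2) n * (qpoch (q ^ (2 * k + 1)) (q ^ 2) n) ^ 2 *
    q ^ (-((n : ℤ) * ((n : ℤ) + 1) / 2) - (2 * (n : ℤ) + 1) * k) /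
    ((qpoch q q n) ^ 2 * qpoch (q ^ 2) (q ^ 2) n)

/-- The function `G(n,k)` of the q-WZ pair, with the convention `1/(q^2;q^2)_m = 0`
for negative `m` (so `G(0,k) = 0`). -/
noncomputable def G (n : ℕ) (k : ℤ) : RatFunc ℚ :=
  if n = 0 then 0 else
    -((1 + q ^ ((n : ℤ) + 2 * k - 1)) * qpoch q (q ^ 2) n *
        (qpoch (q ^ (2 * k + 1)) (q ^ 2) (n - 1)) ^ 2 *
        q ^ (-((n : ℤ) * ((n : ℤ) - 1) / 2) - (2 * (n : ℤ) - 1) * k)) /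
      ((1 - q) * (qpoch q q (n - 1)) ^ 2 * qpoch (q ^ 2) (q ^ 2) (n - 1))

theorem q_ne_zero : q ≠ 0 := RatFunc.X_ne_zero

theorem one_sub_q_pow_ne_zero {n : ℕ} (hn : n ≠ 0) : 1 - q ^ n ≠ 0 := by
  intro h
  have h1 : (algebraMap ℚ[X] (RatFunc ℚ)) (X ^ n) = algebraMap ℚ[X] (RatFunc ℚ) 1 := by
    simpa [q] using (sub_eq_zero.mp h).symm
  have h2 := congrArg natDegree (RatFunc.algebraMap_injective ℚ h1)
  simp [hn] at h2

theorem qpoch_succ (a b : RatFunc ℚ) (n : ℕ) :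
    qpoch a b (n + 1) = qpoch a b n * (1 - a * b ^ n) :=
  prod_range_succ _ n

theorem qpoch_succ' (a b : RatFunc ℚ) (n : ℕ) :
    qpoch a b (n + 1) = (1 - a) * qpoch (a * b) b n := by
  simp only [qpoch, prod_range_succ', pow_zero, mul_one, pow_succ']
  rw [mul_comm]
  simp only [mul_assoc]

theorem qpoch_q_ne_zero (n : ℕ) : qpoch q q n ≠ 0 := by
  refine prod_ne_zero_iff.mpr fun i _ => ?_
  rw [← pow_succ']
  exact one_sub_q_pow_ne_zero i.succ_ne_zero

theorem qpoch_q_sq_ne_zero (n : ℕ) : qpoch (q ^ 2) (q ^ 2) n ≠ 0 := by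
  refine prod_ne_zero_iff.mpr fun i _ => ?_
  rw [← pow_succ', ← pow_mul]
  exact one_sub_q_pow_ne_zero (by positivity)

theorem stmt_12 (n : ℕ) (k : ℤ) : F n (k - 1) - F n k = G (n + 1) k - G n k := by
  have hq := q_ne_zero
  have h1 : 1 - q ≠ 0 := by simpa using one_sub_q_pow_ne_zero one_ne_zero
  have hy : q ^ k ≠ 0 := zpow_ne_zero k hq
  have e1 : q ^ (2 * (k - 1) + 1) = (q ^ k) ^ 2 / q := by
    rw [show 2 * (k - 1) + 1 = k * (2 : ℕ) - 1 by push_cast; ring, zpow_sub_one₀ hq, zpow_mul,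
      zpow_natCast, div_eq_mul_inv]
  have e2 : q ^ (2 * k + 1) = (q ^ k) ^ 2 * q := by
    rw [show 2 * k + 1 = k * (2 : ℕ) + 1 by push_cast; ring, zpow_add_one₀ hq, zpow_mul,
      zpow_natCast]
  rcases n with _ | m
  · have e3 : q ^ (2 * k) = (q ^ k) ^ 2 := by
      rw [mul_comm, zpow_mul]; rfl
    have e4 : q ^ (1 - k) = q / q ^ k := by rw [zpow_sub₀ hq, zpow_one]
    simp [F, G, qint, qpoch, e1, e2, e3, e4]
    field_simp
    ring
  · have hQ := qpoch_q_ne_zero m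
    have hR := qpoch_q_sq_ne_zero m
    have hq1 : 1 - q * q ^ m ≠ 0 := by
      rw [← pow_succ']; exact one_sub_q_pow_ne_zero m.succ_ne_zero
    have hq2 : 1 - q ^ 2 * (q ^ m) ^ 2 ≠ 0 := by
      rw [← pow_mul, ← pow_add]; exact one_sub_q_pow_ne_zero (by positivity)
    have hsq : (q ^ 2) ^ m = (q ^ m) ^ 2 := pow_right_comm q 2 m
    have hsq' : (q ^ 2) ^ (m + 1) = q ^ 2 * (q ^ m) ^ 2 := by rw [pow_succ', hsq]
    have hT : ((m : ℤ) + 1) * (m + 1 + 1) / 2 = (m + 1) * m / 2 + (m + 1) := by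
      rw [show ((m : ℤ) + 1) * (m + 1 + 1) = (m + 1) * m + (m + 1) * 2 by ring]
      exact Int.add_mul_ediv_right _ _ two_ne_zero
    obtain ⟨T, hT'⟩ : ∃ T : ℤ, T = ((m : ℤ) + 1) * m / 2 := ⟨_, rfl⟩
    rw [← hT'] at hT
    have qmono (a b c : ℕ) : q ^ ((a : ℤ) * m + b * k + c) = (q ^ m) ^ a * (q ^ k) ^ b * q ^ c := by
      rw [zpow_add₀ hq, zpow_add₀ hq, mul_comm (a : ℤ), mul_comm (b : ℤ), zpow_mul, zpow_mul]
      simp only [zpow_natCast]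
    obtain ⟨Z, hZ⟩ : ∃ Z, Z = q ^ (-(T + (m + 1)) - (2 * m + 3) * k) := ⟨_, rfl⟩
    have shift (a b c : ℕ) (e : ℤ)
        (he : e = (a * m + b * k + c) + (-(T + (m + 1)) - (2 * m + 3) * k)) :
        q ^ e = (q ^ m) ^ a * (q ^ k) ^ b * q ^ c * Z := by
      rw [he, zpow_add₀ hq, qmono, hZ]
    have hA : qpoch (q ^ (2 * (k - 1) + 1)) (q ^ 2) (m + 1) =
        (1 - (q ^ k) ^ 2 / q) * qpoch ((q ^ k) ^ 2 * q) (q ^ 2) m := by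
      rw [qpoch_succ', e1]
      congr 2
      field_simp
    have i1 : q ^ (3 * ((m : ℤ) + 1) + 2 * (k - 1) + 1) = (q ^ m) ^ 3 * (q ^ k) ^ 2 * q ^ 2 := by
      rw [← qmono]; congr 1; push_cast; ring
    have i2 : q ^ (3 * ((m : ℤ) + 1) + 2 * k + 1) = (q ^ m) ^ 3 * (q ^ k) ^ 2 * q ^ 4 := by
      rw [← qmono]; congr 1; push_cast; ring
    have i3 : q ^ ((m : ℤ) + 1 + 1 + 2 * k - 1) = (q ^ m) ^ 1 * (q ^ k) ^ 2 * q ^ 1 := by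
      rw [← qmono]; congr 1; push_cast; ring
    have i4 : q ^ ((m : ℤ) + 1 + 2 * k - 1) = (q ^ m) ^ 1 * (q ^ k) ^ 2 * q ^ 0 := by
      rw [← qmono]; congr 1; push_cast; ring
    have s1 := shift 2 0 3 (-(T + (m + 1)) - (2 * ((m : ℤ) + 1) + 1) * (k - 1))
      (by push_cast; ring)
    have s2 := shift 0 0 0 (-(T + (m + 1)) - (2 * ((m : ℤ) + 1) + 1) * k) (by push_cast; ring)
    have s3 := shift 0 0 0 (-(T + (m + 1)) - (2 * ((m : ℤ) + 1 + 1) - 1) * k) (by push_cast; ring)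
    have s4 := shift 1 2 1 (-T - (2 * ((m : ℤ) + 1) - 1) * k) (by push_cast; ring)
    have hT2 : ((m : ℤ) + 1 + 1) * (m + 1) / 2 = T + (m + 1) := by rw [mul_comm, hT]
    simp only [F, G, qint, hA, Nat.cast_add, Nat.cast_one, Nat.add_sub_cancel, add_sub_cancel_right,
      Nat.add_eq_zero_iff, one_ne_zero, and_false, if_false, hT, hT2, ← hT', i1, i2, i3, i4,
      s1, s2, s3, s4, e2, qpoch_succ, hsq, hsq']
    generalize qpoch ((q ^ k) ^ 2 * q) (q ^ 2) m = A
    generalize qpoch q (q ^ 2) m = B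
    generalize qpoch q q m = Q at *
    generalize qpoch (q ^ 2) (q ^ 2) m = R at *
    generalize q ^ m = x at *
    generalize q ^ k = y at *
    generalize q = p at *
    generalize hu : 1 - p * x = u at *
    generalize hv : 1 - p ^ 2 * x ^ 2 = v at *
    field_simp
    subst hu hv
    ring
end
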